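/- The Hilbert system obtained by adding to the base logic all instances of the schema (T_G) □_Gφ → φ, for all finite nonempty G ⊆ I, is sound and strongly complete with respect to the class of all models M = (W, (N_i)_{i∈I}, V) in which every N_i is reflexive, i.e., for every world w and every X ∈ N_i(w), w ∈ X. -/

import Mathlib

attribute [local instance] Classical.propDecidable

/-- Formulas of the multi-modal language 𝔏: atoms, ⊥, ¬, ∨, and □_G for
finite nonempty G ⊆ I. -/
inductive Form (I : Type) : Type
  | atom : ℕ → Form I
  | bot  : Form I
  | neg  : Form I → Form I
  | or   : Form I → Form I → Form I
  | box  : (G : Finset I) → G.Nonempty → Form I → Form I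

namespace Form
variable {I : Type}
/-- φ ∧ ψ -/
def and (φ ψ : Form I) : Form I := .neg (.or (.neg φ) (.neg ψ))
/-- φ → ψ -/
def imp (φ ψ : Form I) : Form I := .or (.neg φ) ψ
/-- ⊤ -/
def top : Form I := .neg .bot
/-- φ ↔ ψ -/
def iff (φ ψ : Form I) : Form I := (φ.imp ψ).and (ψ.imp φ)
end Form

/-- The pointwise-intersection neighbourhood function:
`N_G(w) = { ⋂_{i∈G} X_i : X_i ∈ N_i(w) }`. -/
def ptwInter {I W : Type} (N : I → W → Set (Set W)) (G : Finset I) (w : W) :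
    Set (Set W) :=
  { X | ∃ Y : I → Set W, (∀ i ∈ G, Y i ∈ N i w) ∧ X = ⋂ i ∈ G, Y i }

/-- Satisfaction at a world, relative to neighbourhood functions `N` and a
valuation `V`. -/
def satN {I W : Type} (N : I → W → Set (Set W)) (V : ℕ → Set W) :
    Form I → W → Prop
  | .atom n, w => w ∈ V n
  | .bot, _ => False
  | .neg φ, w => ¬ satN N V φ w
  | .or φ ψ, w => satN N V φ w ∨ satN N V ψ w
  | .box G _ φ, w => { v | satN N V φ v } ∈ ptwInter N G w

/-- A neighbourhood model. -/
structure NbhModel (I : Type) where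
  W : Type
  ne : Nonempty W
  N : I → W → Set (Set W)
  V : ℕ → Set W

/-- Truth in a model. -/
def NbhModel.sat {I : Type} (M : NbhModel I) (w : M.W) (φ : Form I) : Prop :=
  satN M.N M.V φ w

/-- Propositional evaluation treating atoms and boxed formulas as atomic. -/
def evalP {I : Type} (v : Form I → Prop) : Form I → Prop
  | .atom n => v (.atom n)
  | .bot => False
  | .neg φ => ¬ evalP v φ
  | .or φ ψ => evalP v φ ∨ evalP v ψ
  | .box G h φ => v (.box G h φ)

/-- Classical propositional tautologies (in the extended modal language). -/
def Tautology {I : Type} (φ : Form I) : Prop := ∀ v, evalP v φ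

theorem unionNE {I : Type} [DecidableEq I] {G H : Finset I}
    (hG : G.Nonempty) : (G ∪ H).Nonempty :=
  hG.mono Finset.subset_union_left

/-- Axiom schema B1: `(□_Gφ ∧ □_Hψ) → □_{G∪H}(φ∧ψ)` for disjoint G, H. -/
def B1Ax (I : Type) [DecidableEq I] : Set (Form I) :=
  { χ | ∃ (G H : Finset I) (hG : G.Nonempty) (hH : H.Nonempty) (φ ψ : Form I),
      Disjoint G H ∧
      χ = ((Form.box G hG φ).and (Form.box H hH ψ)).imp
            (Form.box (G ∪ H) (unionNE hG) (φ.and ψ)) }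

/-- Axiom schema B2: `□_{G∪H}⊤ → □_G⊤`. -/
def B2Ax (I : Type) [DecidableEq I] : Set (Form I) :=
  { χ | ∃ (G H : Finset I) (hG : G.Nonempty) (_hH : H.Nonempty),
      χ = (Form.box (G ∪ H) (unionNE hG) Form.top).imp (Form.box G hG Form.top) }

/-- Axiom schema B3: `(□_Gφ ∧ □_{G∪H∪J}φ) → □_{G∪H}φ`. -/
def B3Ax (I : Type) [DecidableEq I] : Set (Form I) :=
  { χ | ∃ (G H J : Finset I) (hG : G.Nonempty) (_hH : H.Nonempty)
      (_hJ : J.Nonempty) (φ : Form I),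
      χ = ((Form.box G hG φ).and (Form.box (G ∪ H ∪ J) (unionNE (unionNE hG)) φ)).imp
            (Form.box (G ∪ H) (unionNE hG) φ) }

/-- Axiom schema B4: `(□_Gφ ∧ □_H(φ∨ψ)) → □_{G∪H}φ`. -/
def B4Ax (I : Type) [DecidableEq I] : Set (Form I) :=
  { χ | ∃ (G H : Finset I) (hG : G.Nonempty) (hH : H.Nonempty) (φ ψ : Form I),
      χ = ((Form.box G hG φ).and (Form.box H hH (φ.or ψ))).imp
            (Form.box (G ∪ H) (unionNE hG) φ) }

/-- The axioms of the base logic. -/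
def BaseAx (I : Type) [DecidableEq I] : Set (Form I) :=
  B1Ax I ∪ B2Ax I ∪ B3Ax I ∪ B4Ax I

/-- Hilbert-style provability from classical tautologies and the axioms in
`Ax`, closed under modus ponens and replacement of equivalents. -/
inductive Prv {I : Type} (Ax : Set (Form I)) : Form I → Prop
  | taut {φ : Form I} : Tautology φ → Prv Ax φ
  | ax {φ : Form I} : φ ∈ Ax → Prv Ax φ
  | mp {φ ψ : Form I} : Prv Ax (φ.imp ψ) → Prv Ax φ → Prv Ax ψ
  | re {φ ψ : Form I} (G : Finset I) (hG : G.Nonempty) :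
      Prv Ax (φ.iff ψ) → Prv Ax ((Form.box G hG φ).iff (Form.box G hG ψ))

/-- `Γ ⊢ φ` iff there are `ψ₁,…,ψₙ ∈ Γ` with `⊢ (ψ₁∧…∧ψₙ) → φ`. -/
def Deduces {I : Type} (Ax : Set (Form I)) (Γ : Set (Form I)) (φ : Form I) :
    Prop :=
  ∃ l : List (Form I), (∀ ψ ∈ l, ψ ∈ Γ) ∧
    Prv Ax ((l.foldr Form.and Form.top).imp φ)

/-- Semantic consequence over a class of models. -/
def SemConseq {I : Type} (C : NbhModel I → Prop) (Γ : Set (Form I))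
    (φ : Form I) : Prop :=
  ∀ M : NbhModel I, C M → ∀ w : M.W, (∀ ψ ∈ Γ, M.sat w ψ) → M.sat w φ

/-- Soundness and strong completeness of `Ax` w.r.t. the class `C`. -/
def SoundComplete {I : Type} (Ax : Set (Form I)) (C : NbhModel I → Prop) :
    Prop :=
  ∀ (Γ : Set (Form I)) (φ : Form I), Deduces Ax Γ φ ↔ SemConseq C Γ φ

/-- The schema (T_G): □_Gφ → φ for all finite nonempty G ⊆ I. -/
def TAx (I : Type) [DecidableEq I] : Set (Form I) :=
  { χ | ∃ (G : Finset I) (hG : G.Nonempty) (φ : Form I),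
      χ = (Form.box G hG φ).imp φ }

namespace Prv

variable {I : Type} {Ax : Set (Form I)}

/-- Derivability from hypotheses, with replacement of equivalents restricted to theorems. -/
inductive From (Ax Γ : Set (Form I)) : Form I → Prop
  | prv {φ : Form I} : Prv Ax φ → From Ax Γ φ
  | hyp {φ : Form I} : φ ∈ Γ → From Ax Γ φ
  | mp {φ ψ : Form I} : From Ax Γ (φ.imp ψ) → From Ax Γ φ → From Ax Γ ψ

end Prv

open Prv (From)

section Propositional

variable {I : Type} {Ax : Set (Form I)}

theorem evalP_imp (v : Form I → Prop) (φ ψ : Form I) :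
    evalP v (φ.imp ψ) ↔ (evalP v φ → evalP v ψ) := by
  simp only [Form.imp, evalP]; tauto

theorem evalP_and (v : Form I → Prop) (φ ψ : Form I) :
    evalP v (φ.and ψ) ↔ evalP v φ ∧ evalP v ψ := by
  simp only [Form.and, evalP]; tauto

theorem evalP_iff (v : Form I → Prop) (φ ψ : Form I) :
    evalP v (φ.iff ψ) ↔ (evalP v φ ↔ evalP v ψ) := by
  simp only [Form.iff, evalP_and, evalP_imp]; tauto

theorem evalP_top (v : Form I → Prop) : evalP v Form.top := id

theorem evalP_foldr_and (v : Form I → Prop) (l : List (Form I)) :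
    evalP v (l.foldr Form.and Form.top) ↔ ∀ ψ ∈ l, evalP v ψ := by
  induction l with
  | nil => simp [evalP_top]
  | cons a l ih => simp [evalP_and, ih]

namespace Prv.From

variable {Γ Δ : Set (Form I)} {φ ψ χ : Form I}

theorem mono (h : Γ ⊆ Δ) (d : From Ax Γ φ) : From Ax Δ φ := by
  induction d with
  | prv p => exact prv p
  | hyp m => exact hyp (h m)
  | mp _ _ ih₁ ih₂ => exact mp ih₁ ih₂

theorem taut₁ (d : From Ax Γ φ) (h : ∀ v, evalP v φ → evalP v ψ) : From Ax Γ ψ :=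
  mp (prv (Prv.taut fun v => (evalP_imp v _ _).2 (h v))) d

theorem taut₂ (d : From Ax Γ φ) (e : From Ax Γ ψ)
    (h : ∀ v, evalP v φ → evalP v ψ → evalP v χ) : From Ax Γ χ :=
  mp (taut₁ d fun v hφ => (evalP_imp v _ _).2 (h v hφ)) e

theorem deduction (d : From Ax (insert ψ Γ) φ) : From Ax Γ (ψ.imp φ) := by
  induction d with
  | prv p => exact taut₁ (prv p) fun v h => (evalP_imp v _ _).2 fun _ => h
  | hyp m =>
    rcases m with rfl | m
    · exact prv (Prv.taut fun v => (evalP_imp v _ _).2 id)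
    · exact taut₁ (hyp m) fun v h => (evalP_imp v _ _).2 fun _ => h
  | mp _ _ ih₁ ih₂ =>
    refine taut₂ ih₁ ih₂ fun v => ?_
    simp only [evalP_imp]
    tauto

theorem deduces (d : From Ax Γ φ) : Deduces Ax Γ φ := by
  induction d with
  | prv p =>
    exact ⟨[], by simp, Prv.mp (Prv.taut fun v => by simp only [evalP_imp]; tauto) p⟩
  | @hyp φ m =>
    refine ⟨[φ], by simpa using m, Prv.taut fun v => ?_⟩
    simp only [evalP_imp, evalP_foldr_and, List.mem_singleton, forall_eq, imp_self]
  | mp _ _ ih₁ ih₂ =>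
    obtain ⟨l₁, h₁, p₁⟩ := ih₁
    obtain ⟨l₂, h₂, p₂⟩ := ih₂
    refine ⟨l₁ ++ l₂, fun ψ h => (List.mem_append.1 h).elim (h₁ ψ) (h₂ ψ), ?_⟩
    refine Prv.mp (Prv.mp (Prv.taut fun v => ?_) p₁) p₂
    simp only [evalP_imp, evalP_foldr_and, List.mem_append]
    intro a b c
    exact a (fun ψ h => c ψ (Or.inl h)) (b fun ψ h => c ψ (Or.inr h))

theorem exists_of_sUnion {c : Set (Set (Form I))} (hc : IsChain (· ⊆ ·) c) (hne : c.Nonempty)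
    (d : From Ax (⋃₀ c) φ) : ∃ Δ ∈ c, From Ax Δ φ := by
  induction d with
  | prv p => exact hne.imp fun Δ h => ⟨h, prv p⟩
  | hyp m => exact m.imp fun Δ h => ⟨h.1, hyp h.2⟩
  | mp _ _ ih₁ ih₂ =>
    obtain ⟨Δ₁, h₁, d₁⟩ := ih₁
    obtain ⟨Δ₂, h₂, d₂⟩ := ih₂
    rcases hc.total h₁ h₂ with h | h
    · exact ⟨Δ₂, h₂, mp (d₁.mono h) d₂⟩
    · exact ⟨Δ₁, h₁, mp d₁ (d₂.mono h)⟩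

end Prv.From

/-- Maximal consistent sets. -/
structure IsMCS (Ax Δ : Set (Form I)) : Prop where
  mem_of_prv : ∀ {φ}, Prv Ax φ → φ ∈ Δ
  mp : ∀ {φ ψ : Form I}, φ.imp ψ ∈ Δ → φ ∈ Δ → ψ ∈ Δ
  neg_mem : ∀ {φ : Form I}, φ.neg ∈ Δ ↔ φ ∉ Δ

theorem exists_isMCS {Γ : Set (Form I)} {φ : Form I} (h : ¬ From Ax Γ φ) :
    ∃ Δ, IsMCS Ax Δ ∧ Γ ⊆ Δ ∧ φ ∉ Δ := by
  obtain ⟨Δ, hΓ, hmax⟩ := zorn_subset_nonempty {Δ | ¬ From Ax Δ φ}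
    (fun c hc hch hne => ⟨⋃₀ c, fun d => by
      obtain ⟨Δ, hΔ, d⟩ := Prv.From.exists_of_sUnion hch hne d
      exact hc hΔ d, fun s hs => Set.subset_sUnion_of_mem hs⟩) Γ h
  have hφ : ¬ From Ax Δ φ := hmax.prop
  have hins : ∀ ψ, ψ ∉ Δ → From Ax Δ (ψ.imp φ) := fun ψ hψ => by
    by_contra hc
    exact hψ (hmax.le_of_ge (y := insert ψ Δ) (fun d => hc d.deduction)
      (Set.subset_insert ψ Δ) (Set.mem_insert ψ Δ))
  have hclosed : ∀ ψ, From Ax Δ ψ → ψ ∈ Δ := fun ψ d => by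
    by_contra hc
    exact hφ (.mp (hins ψ hc) d)
  refine ⟨Δ, ⟨fun p => hclosed _ (.prv p), fun a b => hclosed _ (.mp (.hyp a) (.hyp b)),
    fun {ψ} => ⟨fun a b => hφ ?_, fun a => ?_⟩⟩, hΓ, fun m => hφ (.hyp m)⟩
  · exact Prv.From.taut₂ (.hyp a) (.hyp b) fun v => by simp only [evalP]; tauto
  · by_contra hn
    refine hφ (Prv.From.taut₂ (hins _ a) (hins _ hn) fun v => ?_)
    simp only [evalP_imp, evalP]
    tauto

namespace IsMCS

variable {Δ : Set (Form I)} {φ ψ : Form I}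

theorem or_mem (h : IsMCS Ax Δ) : φ.or ψ ∈ Δ ↔ φ ∈ Δ ∨ ψ ∈ Δ := by
  constructor
  · intro hor
    by_contra hc
    push Not at hc
    have h₁ := h.neg_mem.2 hc.1
    have ht : ((φ.or ψ).imp (φ.neg.imp ψ)) ∈ Δ := h.mem_of_prv <| Prv.taut fun v => by
      simp only [evalP_imp, evalP]; tauto
    exact hc.2 (h.mp (h.mp ht hor) h₁)
  · rintro (hm | hm)
    · exact h.mp (h.mem_of_prv <| Prv.taut fun v => by simp only [evalP_imp, evalP]; tauto) hm
    · exact h.mp (h.mem_of_prv <| Prv.taut fun v => by simp only [evalP_imp, evalP]; tauto) hm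

theorem bot_notMem (h : IsMCS Ax Δ) : Form.bot ∉ Δ :=
  h.neg_mem.1 (h.mem_of_prv (Prv.taut evalP_top))

theorem and_mem (h : IsMCS Ax Δ) : φ.and ψ ∈ Δ ↔ φ ∈ Δ ∧ ψ ∈ Δ := by
  simp only [Form.and, h.neg_mem, h.or_mem]; tauto

theorem top_mem (h : IsMCS Ax Δ) : Form.top ∈ Δ := h.mem_of_prv (Prv.taut evalP_top)

end IsMCS

variable (Ax) in
/-- The canonical worlds. -/
abbrev MCS : Type := {Δ : Set (Form I) // IsMCS Ax Δ}

variable (Ax) in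
/-- The proof set of a formula. -/
def proofSet (φ : Form I) : Set (MCS Ax) := {Δ | φ ∈ Δ.1}

theorem proofSet_and (φ ψ : Form I) : proofSet Ax (φ.and ψ) = proofSet Ax φ ∩ proofSet Ax ψ :=
  Set.ext fun Δ => Δ.2.and_mem

theorem proofSet_or (φ ψ : Form I) : proofSet Ax (φ.or ψ) = proofSet Ax φ ∪ proofSet Ax ψ :=
  Set.ext fun Δ => Δ.2.or_mem

theorem proofSet_top : proofSet Ax Form.top = Set.univ :=
  Set.eq_univ_of_forall fun Δ => Δ.2.top_mem

theorem prv_of_forall_mem {φ : Form I} (h : ∀ Δ : MCS Ax, φ ∈ Δ.1) : Prv Ax φ := by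
  by_contra hc
  have : ¬ From Ax ∅ φ := fun d => by
    obtain ⟨l, hl, p⟩ := d.deduces
    obtain rfl : l = [] := List.eq_nil_iff_forall_not_mem.2 hl
    exact hc (p.mp (.taut evalP_top))
  obtain ⟨Δ, hΔ, -, hn⟩ := exists_isMCS this
  exact hn (h ⟨Δ, hΔ⟩)

theorem box_mem_congr {φ ψ : Form I} (h : proofSet Ax φ = proofSet Ax ψ) (Δ : MCS Ax)
    {G : Finset I} (hG : G.Nonempty) (hm : Form.box G hG φ ∈ Δ.1) : Form.box G hG ψ ∈ Δ.1 := by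
  have p : Prv Ax (φ.iff ψ) := prv_of_forall_mem fun Θ => by
    have : φ ∈ Θ.1 ↔ ψ ∈ Θ.1 := Set.ext_iff.1 h Θ
    simp only [Form.iff, Form.imp, Θ.2.and_mem, Θ.2.or_mem, Θ.2.neg_mem]
    tauto
  exact Δ.2.mp (Δ.2.and_mem.1 (Δ.2.mem_of_prv (p.re G hG))).1 hm

/-- The sets of canonical worlds boxed by `G` at `Δ`. -/
def boxed (Δ : MCS Ax) (G : Finset I) : Set (Set (MCS Ax)) :=
  {S | ∃ (hG : G.Nonempty) (φ : Form I), S = proofSet Ax φ ∧ Form.box G hG φ ∈ Δ.1}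

theorem proofSet_mem_boxed {Δ : MCS Ax} {G : Finset I} (hG : G.Nonempty) {φ : Form I} :
    proofSet Ax φ ∈ boxed Δ G ↔ Form.box G hG φ ∈ Δ.1 :=
  ⟨fun ⟨_, _, h, hm⟩ => box_mem_congr h.symm Δ hG hm, fun h => ⟨hG, φ, rfl, h⟩⟩

end Propositional

/-- The closure properties of the families of sets boxed by each group that correspond to
the schemas B1 to B4. -/
structure IsBoxFamily {I A : Type} [DecidableEq I] (B : Finset I → Set (Set A)) : Prop where
  inter : ∀ {G H S T}, Disjoint G H → S ∈ B G → T ∈ B H → S ∩ T ∈ B (G ∪ H)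
  univ : ∀ {G H}, G.Nonempty → G ⊆ H → Set.univ ∈ B H → Set.univ ∈ B G
  convex : ∀ {G H J S}, G ⊆ H → H ⊆ J → S ∈ B G → S ∈ B J → S ∈ B H
  absorb : ∀ {G H S T}, S ⊆ T → S ∈ B G → T ∈ B H → S ∈ B (G ∪ H)

theorem isBoxFamily_boxed {I : Type} [DecidableEq I] {Ax : Set (Form I)} (hAx : BaseAx I ⊆ Ax)
    (Δ : MCS Ax) : IsBoxFamily (boxed Δ) where
  inter := by
    rintro G H _ _ hd ⟨hG, φ, rfl, hφ⟩ ⟨hH, ψ, rfl, hψ⟩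
    rw [← proofSet_and, proofSet_mem_boxed (unionNE hG)]
    exact Δ.2.mp (Δ.2.mem_of_prv (.ax (hAx (Or.inl (Or.inl (Or.inl
      ⟨G, H, hG, hH, φ, ψ, hd, rfl⟩)))))) (Δ.2.and_mem.2 ⟨hφ, hψ⟩)
  univ := by
    intro G H hG hGH hu
    have hH := hG.mono hGH
    rw [← proofSet_top, proofSet_mem_boxed hG]
    rw [← proofSet_top, ← Finset.union_eq_right.2 hGH, proofSet_mem_boxed (unionNE hG)] at hu
    exact Δ.2.mp (Δ.2.mem_of_prv (.ax (hAx (Or.inl (Or.inl (Or.inr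
      ⟨G, H, hG, hH, rfl⟩)))))) hu
  convex := by
    rintro G H J _ hGH hHJ ⟨hG, φ, rfl, hφ⟩ hJ
    have hH := hG.mono hGH
    rw [← Finset.union_eq_right.2 hHJ, ← Finset.union_eq_right.2 hGH,
      proofSet_mem_boxed (unionNE (unionNE hG))] at hJ
    rw [← Finset.union_eq_right.2 hGH, proofSet_mem_boxed (unionNE hG)]
    exact Δ.2.mp (Δ.2.mem_of_prv (.ax (hAx (Or.inl (Or.inr
      ⟨G, H, J, hG, hH, hH.mono hHJ, φ, rfl⟩))))) (Δ.2.and_mem.2 ⟨hφ, hJ⟩)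
  absorb := by
    rintro G H _ _ hST ⟨hG, φ, rfl, hφ⟩ ⟨hH, ψ, rfl, hψ⟩
    rw [proofSet_mem_boxed (unionNE hG)]
    have hor : Form.box H hH (φ.or ψ) ∈ Δ.1 :=
      box_mem_congr (by rw [proofSet_or, Set.union_eq_right.2 hST]) Δ hH hψ
    exact Δ.2.mp (Δ.2.mem_of_prv (.ax (hAx (Or.inr
      ⟨G, H, hG, hH, φ, ψ, rfl⟩)))) (Δ.2.and_mem.2 ⟨hφ, hor⟩)

namespace IsBoxFamily

variable {I A : Type} [DecidableEq I] {B : Finset I → Set (Set A)}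

theorem iInter_mem (hB : IsBoxFamily B) {g : I → Finset I} {s : I → Set A} {K : Finset I}
    (hK : K.Nonempty) (hmem : ∀ i ∈ K, s i ∈ B (g i))
    (hd : ∀ i ∈ K, ∀ j ∈ K, Disjoint (g i) (g j) ∨ g i = g j ∧ s i = s j) :
    ⋂ i ∈ K, s i ∈ B (K.biUnion g) := by
  induction hK using Finset.Nonempty.cons_induction with
  | singleton a => simpa using hmem
  | cons a K ha hK ih =>
    have ih := ih (fun i hi => hmem i (Finset.mem_cons_of_mem hi))
      (fun i hi j hj => hd i (Finset.mem_cons_of_mem hi) j (Finset.mem_cons_of_mem hj))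
    rw [Finset.cons_eq_insert, Finset.biUnion_insert, Finset.set_biInter_insert]
    by_cases hex : ∃ j ∈ K, g a = g j ∧ s a = s j
    · obtain ⟨j, hj, hg, hs⟩ := hex
      rw [hg, hs, Finset.union_eq_right.2 (Finset.subset_biUnion_of_mem g hj),
        Set.inter_eq_right.2 (Set.iInter₂_subset (s := fun i _ => s i) j hj)]
      exact ih
    · refine hB.inter ?_ (hmem a (Finset.mem_cons_self a K)) ih
      rw [Finset.disjoint_biUnion_right]
      exact fun j hj => (hd a (Finset.mem_cons_self a K) j
        (Finset.mem_cons_of_mem hj)).resolve_right fun h => hex ⟨j, hj, h⟩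

theorem absorb_biUnion (hB : IsBoxFamily B) {g : I → Finset I} {s : I → Set A} {F : Finset I}
    {S : Set A} (hF : S ∈ B F) (K : Finset I) (hmem : ∀ i ∈ K, s i ∈ B (g i))
    (hS : ∀ i ∈ K, S ⊆ s i) : S ∈ B (F ∪ K.biUnion g) := by
  induction K using Finset.induction_on with
  | empty => simpa using hF
  | insert a K _ ih =>
    rw [Finset.biUnion_insert, Finset.union_comm (g a), ← Finset.union_assoc]
    exact hB.absorb (hS a (Finset.mem_insert_self a K))
      (ih (fun i hi => hmem i (Finset.mem_insert_of_mem hi))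
        (fun i hi => hS i (Finset.mem_insert_of_mem hi)))
      (hmem a (Finset.mem_insert_self a K))

/-- If the groups `g i`, for `i ∈ H`, on which `(g, s)` is constant have intersection `S`, and
`S` is contained in all the `s i`, then `S` is boxed by `H`. -/
theorem mem_of_iInter_eq (hB : IsBoxFamily B) {g : I → Finset I} {s : I → Set A} {H : Finset I}
    {S : Set A} (hH : H.Nonempty) (hg : ∀ i ∈ H, i ∈ g i) (hmem : ∀ i ∈ H, s i ∈ B (g i))
    (hS : ∀ i ∈ H, S ⊆ s i)
    (hfull : ∀ a, (∀ i ∈ H, (∀ j ∈ g i, j ∈ H ∧ g j = g i ∧ s j = s i) → a ∈ s i) → a ∈ S) :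
    S ∈ B H := by
  let F : Finset I := {i ∈ H | ∀ j ∈ g i, j ∈ H ∧ g j = g i ∧ s j = s i}
  have memF : ∀ i, i ∈ F ↔ i ∈ H ∧ ∀ j ∈ g i, j ∈ H ∧ g j = g i ∧ s j = s i := fun i =>
    Finset.mem_filter
  have hFH : F ⊆ H := Finset.filter_subset _ _
  rcases F.eq_empty_or_nonempty with hF | hF
  · have hSu : S = Set.univ := Set.eq_univ_of_forall fun a => hfull a fun i hi hj => by
      have : i ∈ F := (memF i).2 ⟨hi, hj⟩
      simp [hF] at this
    have hu : ∀ i ∈ H, Set.univ ∈ B {i} := fun i hi => by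
      refine hB.univ (Finset.singleton_nonempty i) (Finset.singleton_subset_iff.2 (hg i hi)) ?_
      have := hmem i hi
      rwa [show s i = Set.univ from Set.univ_subset_iff.1 (hSu ▸ hS i hi)] at this
    have := hB.iInter_mem (g := fun i => {i}) (s := fun _ => Set.univ) hH hu fun i _ j _ => by
      by_cases h : i = j
      · exact Or.inr ⟨by rw [h], rfl⟩
      · exact Or.inl (Finset.disjoint_singleton.2 h)
    rw [Finset.biUnion_singleton_eq_self] at this
    simpa [hSu] using this
  · have hunion : F.biUnion g = F := by
      ext k
      rw [Finset.mem_biUnion]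
      constructor
      · rintro ⟨i, hi, hk⟩
        have hi := ((memF i).1 hi).2
        obtain ⟨hkH, hgk, hsk⟩ := hi k hk
        refine (memF k).2 ⟨hkH, ?_⟩
        rwa [hgk, hsk]
      · exact fun hk => ⟨k, hk, hg k (hFH hk)⟩
    have hinter : ⋂ i ∈ F, s i = S := by
      refine Set.Subset.antisymm (fun a ha => hfull a fun i hi hj => ?_)
        (Set.subset_iInter₂ fun i hi => hS i (hFH hi))
      exact Set.mem_iInter₂.1 ha i ((memF i).2 ⟨hi, hj⟩)
    have hSF : S ∈ B F := by
      have := hB.iInter_mem hF (fun i hi => hmem i (hFH hi)) fun i hi j hj => by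
        refine or_iff_not_imp_left.2 fun hnd => ?_
        obtain ⟨k, hki, hkj⟩ := Finset.not_disjoint_iff.1 hnd
        have h₁ := (((memF i).1 hi).2 k hki).2
        have h₂ := (((memF j).1 hj).2 k hkj).2
        exact ⟨h₁.1.symm.trans h₂.1, h₁.2.symm.trans h₂.2⟩
      rwa [hunion, hinter] at this
    refine hB.convex hFH ?_ hSF (hB.absorb_biUnion hSF H hmem hS)
    exact fun i hi => Finset.mem_union_right _ (Finset.mem_biUnion.2 ⟨i, hi, hg i hi⟩)

end IsBoxFamily

section Tagged

/-- A tag selects, for every group and every set of worlds, a member of the group. -/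
abbrev Tag (I A : Type) : Type := ∀ G : Finset I, G.Nonempty → Set A → {i // i ∈ G}

/-- The part contributed by the agent `i` to the set `S` boxed by `G`: tagged worlds outside `S`
are excluded only by the agent selected by their tag. -/
def share {I A : Type} (G : Finset I) (hG : G.Nonempty) (S : Set A) (i : I) :
    Set (A × Tag I A) :=
  {p | p.1 ∈ S ∨ (p.2 G hG S : I) ≠ i}

/-- The neighbourhood functions on tagged worlds generated by the shares of boxed sets. -/
def shareNbhd {I A : Type} (B : A → Finset I → Set (Set A)) (i : I) (p : A × Tag I A) :
    Set (Set (A × Tag I A)) :=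
  {X | ∃ (G : Finset I) (hG : G.Nonempty) (S : Set A), i ∈ G ∧ S ∈ B p.1 G ∧ X = share G hG S i}

theorem mem_ptwInter_shareNbhd {I A : Type} [DecidableEq I] {B : A → Finset I → Set (Set A)}
    (hB : ∀ a, IsBoxFamily (B a)) {H : Finset I} (hH : H.Nonempty) (p : A × Tag I A)
    (S : Set A) : Prod.fst ⁻¹' S ∈ ptwInter (shareNbhd B) H p ↔ S ∈ B p.1 H := by
  constructor
  · rintro ⟨Y, hY, hSY⟩
    have hY' : ∀ i, ∃ (G : Finset I) (S : Set A), i ∈ H →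
        ∃ hG : G.Nonempty, i ∈ G ∧ S ∈ B p.1 G ∧ Y i = share G hG S i := fun i => by
      by_cases hi : i ∈ H
      · obtain ⟨G, hG, S, h⟩ := hY i hi
        exact ⟨G, S, fun _ => ⟨hG, h⟩⟩
      · exact ⟨∅, ∅, fun h => absurd h hi⟩
    choose g s hgs using hY'
    have mem_S : ∀ a f, a ∈ S ↔ ∀ i ∈ H, (a, f) ∈ Y i := fun a f => by
      simpa using Set.ext_iff.1 hSY (a, f)
    refine (hB p.1).mem_of_iInter_eq (g := g) (s := s) hH (fun i hi => (hgs i hi).2.1)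
      (fun i hi => (hgs i hi).2.2.1) (fun i hi a ha => ?_) fun a ha => ?_
    · obtain ⟨hG, hig, -, hYi⟩ := hgs i hi
      let f : Tag I A := fun G hG _ => if h : i ∈ G then ⟨i, h⟩ else ⟨hG.choose, hG.choose_spec⟩
      have := (mem_S a f).1 ha i hi
      rw [hYi] at this
      exact this.resolve_right fun hne => hne (by simp [f, hig])
    · let f : Tag I A := fun G hG T =>
        if h : ∃ j ∈ G, ¬ (j ∈ H ∧ g j = G ∧ s j = T) then ⟨h.choose, h.choose_spec.1⟩
        else ⟨hG.choose, hG.choose_spec⟩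
      refine (mem_S a f).2 fun i hi => ?_
      obtain ⟨hG, hig, -, hYi⟩ := hgs i hi
      rw [hYi]
      by_cases h : ∃ j ∈ g i, ¬ (j ∈ H ∧ g j = g i ∧ s j = s i)
      · right
        simp only [f, dif_pos h]
        intro he
        exact h.choose_spec.2 (by rw [he]; exact ⟨hi, rfl, rfl⟩)
      · left
        push Not at h
        exact ha i hi h
  · intro hS
    refine ⟨share H hH S, fun i hi => ⟨H, hH, S, hi, hS, rfl⟩, ?_⟩
    ext ⟨a, f⟩
    simp only [Set.mem_preimage, Set.mem_iInter, share, Set.mem_ofPred_eq]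
    exact ⟨fun h _ _ => Or.inl h, fun h => (h _ (f H hH S).2).resolve_right fun hn => hn rfl⟩

end Tagged

section Canonical

variable {I : Type} {Ax : Set (Form I)}

variable (Ax) in
/-- The tagged canonical neighbourhood functions. -/
def canonicalNbhd : I → MCS Ax × Tag I (MCS Ax) → Set (Set (MCS Ax × Tag I (MCS Ax))) :=
  shareNbhd boxed

variable (Ax) in
/-- The tagged canonical valuation. -/
def canonicalVal (n : ℕ) : Set (MCS Ax × Tag I (MCS Ax)) := {p | Form.atom n ∈ p.1.1}

theorem satN_canonical [DecidableEq I] (hAx : BaseAx I ⊆ Ax) (φ : Form I)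
    (p : MCS Ax × Tag I (MCS Ax)) :
    satN (canonicalNbhd Ax) (canonicalVal Ax) φ p ↔ φ ∈ p.1.1 := by
  induction φ generalizing p with
  | atom n => rfl
  | bot => exact ⟨False.elim, p.1.2.bot_notMem⟩
  | neg φ ih => rw [p.1.2.neg_mem, ← ih]; rfl
  | or φ ψ ih₁ ih₂ => rw [p.1.2.or_mem, ← ih₁, ← ih₂]; rfl
  | box G hG φ ih =>
    have hset : {q | satN (canonicalNbhd Ax) (canonicalVal Ax) φ q} =
        Prod.fst ⁻¹' proofSet Ax φ := Set.ext ih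
    rw [satN, hset, canonicalNbhd, mem_ptwInter_shareNbhd (isBoxFamily_boxed hAx) hG,
      proofSet_mem_boxed hG]

end Canonical

section Soundness

variable {I W : Type} {N : I → W → Set (Set W)} {V : ℕ → Set W}

theorem evalP_satN (w : W) (φ : Form I) :
    evalP (fun ψ => satN N V ψ w) φ ↔ satN N V φ w := by
  induction φ with
  | atom n => rfl
  | bot => rfl
  | neg φ ih => simp only [evalP, satN, ih]
  | or φ ψ ih₁ ih₂ => simp only [evalP, satN, ih₁, ih₂]
  | box G hG φ => rfl

theorem satN_imp (w : W) (φ ψ : Form I) :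
    satN N V (φ.imp ψ) w ↔ (satN N V φ w → satN N V ψ w) := by
  rw [← evalP_satN, evalP_imp, evalP_satN, evalP_satN]

theorem satN_and (w : W) (φ ψ : Form I) :
    satN N V (φ.and ψ) w ↔ satN N V φ w ∧ satN N V ψ w := by
  rw [← evalP_satN, evalP_and, evalP_satN, evalP_satN]

theorem satN_iff (w : W) (φ ψ : Form I) :
    satN N V (φ.iff ψ) w ↔ (satN N V φ w ↔ satN N V ψ w) := by
  rw [← evalP_satN, evalP_iff, evalP_satN, evalP_satN]

theorem satN_foldr_and (w : W) (l : List (Form I)) :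
    satN N V (l.foldr Form.and Form.top) w ↔ ∀ ψ ∈ l, satN N V ψ w := by
  rw [← evalP_satN, evalP_foldr_and]
  simp only [evalP_satN]

/-- Two families of neighbourhoods can be merged, the first one taking precedence. -/
theorem inter_mem_ptwInter_union [DecidableEq I] {G H : Finset I} {w : W} {Y Z : I → Set W}
    (hY : ∀ i ∈ G, Y i ∈ N i w) (hZ : ∀ i ∈ H, Z i ∈ N i w) :
    (⋂ i ∈ G, Y i) ∩ ⋂ i ∈ H \ G, Z i ∈ ptwInter N (G ∪ H) w := by
  refine ⟨fun i => if i ∈ G then Y i else Z i, fun i hi => ?_, ?_⟩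
  · by_cases h : i ∈ G
    · simpa [h] using hY i h
    · simpa [h] using hZ i ((Finset.mem_union.1 hi).resolve_left h)
  · ext v
    simp only [Set.mem_inter_iff, Set.mem_iInter, Finset.mem_sdiff, Finset.mem_union]
    constructor
    · rintro ⟨h₁, h₂⟩ i hi
      by_cases h : i ∈ G
      · simpa [h] using h₁ i h
      · simpa [h] using h₂ i ⟨hi.resolve_left h, h⟩
    · intro h
      refine ⟨fun i hi => ?_, fun i hi => ?_⟩
      · simpa [hi] using h i (Or.inl hi)
      · simpa [hi.2] using h i (Or.inr hi.1)

theorem mem_ptwInter_union_of_subset [DecidableEq I] {G H : Finset I} {w : W} {S : Set W}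
    {Z : I → Set W} (hS : S ∈ ptwInter N G w) (hZ : ∀ i ∈ H, Z i ∈ N i w ∧ S ⊆ Z i) :
    S ∈ ptwInter N (G ∪ H) w := by
  obtain ⟨Y, hY, hSY⟩ := hS
  have := inter_mem_ptwInter_union hY fun i hi => (hZ i hi).1
  rwa [← hSY, Set.inter_eq_left.2] at this
  exact Set.subset_iInter₂ fun i hi => (hZ i (Finset.mem_sdiff.1 hi).1).2

theorem satN_of_mem_baseAx [DecidableEq I] {χ : Form I} (h : χ ∈ BaseAx I) (w : W) :
    satN N V χ w := by
  rcases h with ((⟨G, H, hG, hH, φ, ψ, hd, rfl⟩ | ⟨G, H, hG, hH, rfl⟩) |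
    ⟨G, H, J, hG, hH, hJ, φ, rfl⟩) | ⟨G, H, hG, hH, φ, ψ, rfl⟩
  · rw [satN_imp, satN_and]
    rintro ⟨⟨Y, hY, hSY⟩, ⟨Z, hZ, hSZ⟩⟩
    have := inter_mem_ptwInter_union hY hZ
    rw [hd.symm.sdiff_eq_left, ← hSY, ← hSZ] at this
    simpa only [satN, satN_and, Set.ofPred_and] using this
  · rw [satN_imp]
    rintro ⟨Y, hY, hSY⟩
    refine ⟨fun _ => Set.univ, fun i hi => ?_, ?_⟩
    · have hu : Y i = Set.univ := Set.eq_univ_of_forall fun v =>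
        Set.mem_iInter₂.1 (hSY.subset (show satN N V Form.top v from id)) i (Finset.mem_union_left H hi)
      exact hu ▸ hY i (Finset.mem_union_left H hi)
    · simp [Form.top, satN]
  · rw [satN_imp, satN_and]
    rintro ⟨hS, ⟨Z, hZ, hSZ⟩⟩
    refine mem_ptwInter_union_of_subset (Z := Z) hS fun i hi => ?_
    have hi : i ∈ G ∪ H ∪ J := Finset.mem_union_left J (Finset.mem_union_right G hi)
    exact ⟨hZ i hi, hSZ ▸ Set.biInter_subset_of_mem (Finset.mem_coe.2 hi)⟩
  · rw [satN_imp, satN_and]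
    rintro ⟨hS, ⟨Z, hZ, hSZ⟩⟩
    refine mem_ptwInter_union_of_subset (Z := Z) hS fun i hi => ⟨hZ i hi, ?_⟩
    exact fun v hv => Set.mem_iInter₂.1 (hSZ ▸ Or.inl hv : v ∈ ⋂ i ∈ H, Z i) i hi

theorem satN_of_mem_TAx [DecidableEq I] (hN : ∀ i w, ∀ X ∈ N i w, w ∈ X) {χ : Form I}
    (h : χ ∈ TAx I) (w : W) : satN N V χ w := by
  obtain ⟨G, hG, φ, rfl⟩ := h
  rw [satN_imp]
  rintro ⟨Y, hY, hSY⟩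
  have : w ∈ {v | satN N V φ v} := by
    rw [hSY]
    exact Set.mem_iInter₂.2 fun i hi => hN i w _ (hY i hi)
  exact this

theorem Prv.satN {Ax : Set (Form I)} (hAx : ∀ χ ∈ Ax, ∀ w, satN N V χ w) {φ : Form I}
    (p : Prv Ax φ) (w : W) : satN N V φ w := by
  induction p generalizing w with
  | taut h => exact (evalP_satN w _).1 (h _)
  | ax h => exact hAx _ h w
  | mp _ _ ih₁ ih₂ => exact (satN_imp w _ _).1 (ih₁ w) (ih₂ w)
  | @re φ ψ G hG _ ih =>
    have hset : {v | _root_.satN N V φ v} = {v | _root_.satN N V ψ v} :=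
      Set.ext fun v => (satN_iff v _ _).1 (ih v)
    rw [satN_iff, _root_.satN, _root_.satN, hset]

end Soundness

/-- The base logic plus all instances of (T_G) is sound and
strongly complete w.r.t. the class of models in which every N_i is
reflexive. -/
theorem T_sound_complete (I : Type) [DecidableEq I] :
    SoundComplete (BaseAx I ∪ TAx I)
      (fun M : NbhModel I => ∀ (i : I) (w : M.W) (X : Set M.W),
        X ∈ M.N i w → w ∈ X) := by
  intro Γ φ
  constructor
  · rintro ⟨l, hl, p⟩ M hM w hΓ
    have hAx : ∀ χ ∈ BaseAx I ∪ TAx I, ∀ v, satN M.N M.V χ v := by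
      rintro χ (h | h) v
      · exact satN_of_mem_baseAx h v
      · exact satN_of_mem_TAx hM h v
    exact (satN_imp w _ _).1 (p.satN hAx w)
      ((satN_foldr_and w l).2 fun ψ hψ => hΓ ψ (hl ψ hψ))
  · intro h
    by_contra hc
    obtain ⟨Δ, hΔ, hΓΔ, hφ⟩ := exists_isMCS fun d => hc (Prv.From.deduces d)
    let p : MCS (BaseAx I ∪ TAx I) × Tag I (MCS (BaseAx I ∪ TAx I)) :=
      (⟨Δ, hΔ⟩, fun G hG _ => ⟨hG.choose, hG.choose_spec⟩)
    have truth := satN_canonical (Set.subset_union_left : BaseAx I ⊆ BaseAx I ∪ TAx I)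
    refine hφ ((truth φ p).1 (h ⟨_, ⟨p⟩, canonicalNbhd _, canonicalVal _⟩ ?_ p
      fun ψ hψ => (truth ψ p).2 (hΓΔ hψ)))
    rintro i q X ⟨G, hG, S, -, ⟨hG', ψ, rfl, hψ⟩, rfl⟩
    exact Or.inl (q.1.2.mp (q.1.2.mem_of_prv (.ax (Or.inr ⟨G, hG', ψ, rfl⟩))) hψ)
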